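/- If x1, x1', x2, x3 ∈ X with x1' ⪰ x1, then |H((x1' − x1) ∗ (x2 − x3))| ≤ H(x1' − x1), where ∗ denotes either ⊛ or ⊠, and the operations and H are extended bilinearly and linearly to signed measures. -/

import Mathlib

open MeasureTheory Real Filter Topology Polynomial

noncomputable section

/-- The space of finite signed Borel measures on the extended reals `ℝ̄`. -/
abbrev SM := MeasureTheory.SignedMeasure EReal

namespace SCLDPC

/-- The weight `e^{-α/2}` as an extended nonnegative real (`+∞` at `α = -∞`). -/
def wt (α : EReal) : ENNReal :=
  if α = ⊥ then ⊤ else if α = ⊤ then 0 else ENNReal.ofReal (Real.exp (-(α.toReal) / 2))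

/-- A (nonnegative) Borel measure `μ` on `ℝ̄` is symmetric if
`∫_{-E} e^{-α/2} μ(dα) = ∫_{E} e^{-α/2} μ(dα)` for every Borel set `E`
(stated with extended nonnegative integrals, which is equivalent to requiring
equality whenever one of the two sides is finite). -/
def IsSymmMeasure (μ : Measure EReal) : Prop :=
  ∀ E : Set EReal, MeasurableSet E →
    ∫⁻ α in (fun a : EReal => -a) ⁻¹' E, wt α ∂μ = ∫⁻ α in E, wt α ∂μ

/-- Positive part of the Jordan decomposition. -/
def jp (x : SM) : Measure EReal := x.toJordanDecomposition.posPart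

/-- Negative part of the Jordan decomposition. -/
def jn (x : SM) : Measure EReal := x.toJordanDecomposition.negPart

instance (x : SM) : IsFiniteMeasure (jp x) := x.toJordanDecomposition.posPart_finite

instance (x : SM) : IsFiniteMeasure (jn x) := x.toJordanDecomposition.negPart_finite

/-- A finite signed Borel measure on `ℝ̄` is symmetric iff both parts of its Jordan
decomposition are symmetric measures. -/
def IsSymm (x : SM) : Prop := IsSymmMeasure (jp x) ∧ IsSymmMeasure (jn x)

/-- Membership in `X`, the set of symmetric probability measures on `ℝ̄`. -/
def MemX (x : SM) : Prop :=
  (∃ (μ : Measure EReal) (hμ : IsProbabilityMeasure μ),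
      x = (letI := hμ; μ.toSignedMeasure)) ∧ IsSymm x

/-- Membership in `X_d`, the set of differences of symmetric probability measures. -/
def MemXd (y : SM) : Prop := ∃ x1 x2 : SM, MemX x1 ∧ MemX x2 ∧ y = x1 - x2

/-- Integral of a real function against a finite signed measure. -/
def sInt (f : EReal → ℝ) (x : SM) : ℝ := (∫ α, f α ∂(jp x)) - ∫ α, f α ∂(jn x)

/-- `tanh(α/2)` extended continuously to `ℝ̄`. -/
def tanhHalf (α : EReal) : ℝ :=
  if α = ⊤ then 1 else if α = ⊥ then -1 else Real.tanh (α.toReal / 2)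

/-- The inverse hyperbolic tangent on `(-1, 1)`. -/
def artanh (t : ℝ) : ℝ := Real.log ((1 + t) / (1 - t)) / 2

/-- `2 tanh⁻¹(t)` valued in `ℝ̄` (sending `t ≥ 1` to `+∞` and `t ≤ -1` to `-∞`). -/
def atanhTwo (t : ℝ) : EReal :=
  if 1 ≤ t then ⊤ else if t ≤ -1 then ⊥ else ((2 * artanh t : ℝ) : EReal)

/-- Variable-node convolution `⊛` of two (nonnegative) measures:
`(μ ⊛ ν)(E) = ∫ μ(E - α) ν(dα)`, i.e. the pushforward of `μ × ν` under addition. -/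
def mConv (μ ν : Measure EReal) : Measure EReal :=
  (μ.prod ν).map fun p => p.1 + p.2

/-- Check-node convolution `⊠` of two (nonnegative) measures:
`(μ ⊠ ν)(E) = ∫ μ(2 tanh⁻¹(tanh(E/2) / tanh(α/2))) ν(dα)`, where the argument of `μ`
is the image of `E` under `β ↦ 2 tanh⁻¹(tanh(β/2) / tanh(α/2))`; equivalently, the
pushforward of `μ × ν` under `(β, α) ↦ 2 tanh⁻¹(tanh(β/2) · tanh(α/2))`. -/
def mCheck (μ ν : Measure EReal) : Measure EReal :=
  (μ.prod ν).map fun p => atanhTwo (tanhHalf p.1 * tanhHalf p.2)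

instance (μ ν : Measure EReal) [IsFiniteMeasure μ] [IsFiniteMeasure ν] :
    IsFiniteMeasure (mConv μ ν) := by unfold mConv; infer_instance

instance (μ ν : Measure EReal) [IsFiniteMeasure μ] [IsFiniteMeasure ν] :
    IsFiniteMeasure (mCheck μ ν) := by unfold mCheck; infer_instance

/-- The variable-node operation `⊛` extended bilinearly to finite signed measures. -/
def sConv (x y : SM) : SM :=
  (mConv (jp x) (jp y)).toSignedMeasure - (mConv (jp x) (jn y)).toSignedMeasure
    - (mConv (jn x) (jp y)).toSignedMeasure + (mConv (jn x) (jn y)).toSignedMeasure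

/-- The check-node operation `⊠` extended bilinearly to finite signed measures. -/
def sCheck (x y : SM) : SM :=
  (mCheck (jp x) (jp y)).toSignedMeasure - (mCheck (jp x) (jn y)).toSignedMeasure
    - (mCheck (jn x) (jp y)).toSignedMeasure + (mCheck (jn x) (jn y)).toSignedMeasure

/-- The integrand `log₂(1 + e^{-α})` of the entropy functional (with the harmless
convention that it vanishes at `α = ±∞`; symmetric measures put no mass at `-∞`). -/
def entFn (α : EReal) : ℝ :=
  if α = ⊤ then 0 else if α = ⊥ then 0 else Real.logb 2 (1 + Real.exp (-(α.toReal)))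

/-- The entropy functional `H(x) = ∫ log₂(1 + e^{-α}) x(dα)`. -/
def H (x : SM) : ℝ := sInt entFn x

/-- `I_f(x) = ∫ f(|tanh(α/2)|) x(dα)`. -/
def If (f : ℝ → ℝ) (x : SM) : ℝ := sInt (fun α => f |tanhHalf α|) x

/-- `x1` is degraded with respect to `x2` (written `x1 ⪰ x2`): `I_f(x1) ≥ I_f(x2)` for
every concave non-increasing `f : [0,1] → ℝ`. -/
def Degraded (x1 x2 : SM) : Prop :=
  ∀ f : ℝ → ℝ, ConcaveOn ℝ (Set.Icc (0 : ℝ) 1) f → AntitoneOn f (Set.Icc (0 : ℝ) 1) →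
    If f x2 ≤ If f x1

/-- `x1` is strictly degraded with respect to `x2` (written `x1 ≻ x2`). -/
def StrictlyDegraded (x1 x2 : SM) : Prop :=
  Degraded x1 x2 ∧ ∃ f : ℝ → ℝ, ConcaveOn ℝ (Set.Icc (0 : ℝ) 1) f ∧
    AntitoneOn f (Set.Icc (0 : ℝ) 1) ∧ If f x2 < If f x1


/-! ### Jordan decomposition helpers -/

lemma jp_le (μ ν : Measure EReal) [IsFiniteMeasure μ] [IsFiniteMeasure ν] :
    jp (μ.toSignedMeasure - ν.toSignedMeasure) ≤ μ := by
  unfold jp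
  rw [Measure.toJordanDecomposition_toSignedMeasure_sub]
  exact Measure.sub_le

lemma jn_le (μ ν : Measure EReal) [IsFiniteMeasure μ] [IsFiniteMeasure ν] :
    jn (μ.toSignedMeasure - ν.toSignedMeasure) ≤ ν := by
  unfold jn
  rw [Measure.toJordanDecomposition_toSignedMeasure_sub]
  exact Measure.sub_le

lemma jordan_add (μ ν : Measure EReal) [IsFiniteMeasure μ] [IsFiniteMeasure ν] :
    jp (μ.toSignedMeasure - ν.toSignedMeasure) + ν
      = jn (μ.toSignedMeasure - ν.toSignedMeasure) + μ := by
  rw [← Measure.toSignedMeasure_eq_toSignedMeasure_iff, Measure.toSignedMeasure_add,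
    Measure.toSignedMeasure_add]
  have h := SignedMeasure.toSignedMeasure_toJordanDecomposition
    (μ.toSignedMeasure - ν.toSignedMeasure)
  unfold JordanDecomposition.toSignedMeasure at h
  change (jp (μ.toSignedMeasure - ν.toSignedMeasure)).toSignedMeasure
    - (jn (μ.toSignedMeasure - ν.toSignedMeasure)).toSignedMeasure = _ at h
  rw [sub_eq_sub_iff_add_eq_add] at h
  rw [h, add_comm]

lemma sInt_sub (μ ν : Measure EReal) [IsFiniteMeasure μ] [IsFiniteMeasure ν] (f : EReal → ℝ)
    (hμ : Integrable f μ) (hν : Integrable f ν) :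
    sInt f (μ.toSignedMeasure - ν.toSignedMeasure) = ∫ a, f a ∂μ - ∫ a, f a ∂ν := by
  have h : ∫ a, f a ∂(jp (μ.toSignedMeasure - ν.toSignedMeasure) + ν)
      = ∫ a, f a ∂(jn (μ.toSignedMeasure - ν.toSignedMeasure) + μ) := by rw [jordan_add μ ν]
  rw [integral_add_measure (hμ.mono_measure (jp_le μ ν)) hν,
    integral_add_measure (hν.mono_measure (jn_le μ ν)) hμ] at h
  unfold sInt
  linarith

lemma sInt_pos (μ : Measure EReal) [IsFiniteMeasure μ] (f : EReal → ℝ)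
    (hμ : Integrable f μ) : sInt f μ.toSignedMeasure = ∫ a, f a ∂μ := by
  have := sInt_sub μ 0 f hμ (integrable_zero_measure)
  simpa using this

lemma jp_pos (μ : Measure EReal) [IsFiniteMeasure μ] : jp μ.toSignedMeasure = μ := by
  have h := jordan_add μ 0
  have h2 := jn_le μ 0
  simp only [Measure.toSignedMeasure_zero, sub_zero, add_zero] at h h2
  rw [h, le_antisymm h2 (Measure.zero_le _), zero_add]

/-! ### Bilinear forms -/

/-- Bilinear combination over Jordan parts equals that over the original measures. -/
lemma bilin (k : EReal × EReal → ℝ) (μ' μ ν ν' : Measure EReal) [IsFiniteMeasure μ']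
    [IsFiniteMeasure μ] [IsFiniteMeasure ν] [IsFiniteMeasure ν']
    (hk : Integrable k ((μ' + μ).prod (ν + ν'))) (p n P N : Measure EReal)
    [IsFiniteMeasure p] [IsFiniteMeasure n] [IsFiniteMeasure P] [IsFiniteMeasure N]
    (hp : p ≤ μ') (hn : n ≤ μ) (hP : P ≤ ν) (hN : N ≤ ν')
    (h1 : p + μ = n + μ') (h2 : P + ν' = N + ν) :
    ∫ z, k z ∂(p.prod P) - ∫ z, k z ∂(p.prod N) - ∫ z, k z ∂(n.prod P) + ∫ z, k z ∂(n.prod N)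
    = ∫ z, k z ∂(μ'.prod ν) - ∫ z, k z ∂(μ'.prod ν') - ∫ z, k z ∂(μ.prod ν)
      + ∫ z, k z ∂(μ.prod ν') := by
  have a1 : μ' ≤ μ' + μ := Measure.le_add_right le_rfl
  have a2 : μ ≤ μ' + μ := Measure.le_add_left le_rfl
  have b1 : ν ≤ ν + ν' := Measure.le_add_right le_rfl
  have b2 : ν' ≤ ν + ν' := Measure.le_add_left le_rfl
  have I : ∀ (A B : Measure EReal) [IsFiniteMeasure A] [IsFiniteMeasure B],
      A ≤ μ' + μ → B ≤ ν + ν' → Integrable k (A.prod B) := fun A B _ _ hA hB =>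
    hk.mono_measure (Measure.prod_mono hA hB)
  have L : ∀ (B : Measure EReal) [IsFiniteMeasure B], B ≤ ν + ν' →
      ∫ z, k z ∂(p.prod B) + ∫ z, k z ∂(μ.prod B) =
      ∫ z, k z ∂(n.prod B) + ∫ z, k z ∂(μ'.prod B) := by
    intro B _ hB
    rw [← integral_add_measure (I p B (hp.trans a1) hB) (I μ B a2 hB),
      ← integral_add_measure (I n B (hn.trans a2) hB) (I μ' B a1 hB),
      ← Measure.add_prod, ← Measure.add_prod, h1]
  have R : ∀ (A : Measure EReal) [IsFiniteMeasure A], A ≤ μ' + μ →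
      ∫ z, k z ∂(A.prod P) + ∫ z, k z ∂(A.prod ν') =
      ∫ z, k z ∂(A.prod N) + ∫ z, k z ∂(A.prod ν) := by
    intro A _ hA
    rw [← integral_add_measure (I A P hA (hP.trans b1)) (I A ν' hA b2),
      ← integral_add_measure (I A N hA (hN.trans b2)) (I A ν hA b1),
      ← Measure.prod_add, ← Measure.prod_add, h2]
  have := L P (hP.trans b1)
  have := L N (hN.trans b2)
  have := R μ' a1
  have := R μ a2
  linarith

/-! ### The kernels -/

/-- `log₂ (2 / (1 + t))`. -/
def G (t : ℝ) : ℝ := Real.logb 2 (2 / (1 + t))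

/-- Binary entropy in the `tanh` coordinate. -/
def hh (t : ℝ) : ℝ := Real.binEntropy ((1 + t) / 2) / Real.log 2

lemma tanhHalf_top : tanhHalf ⊤ = 1 := by simp [tanhHalf]
lemma tanhHalf_bot : tanhHalf ⊥ = -1 := by simp [tanhHalf]
lemma tanhHalf_coe (r : ℝ) : tanhHalf (r : EReal) = Real.tanh (r / 2) := by simp [tanhHalf]

lemma tanhHalf_neg (a : EReal) : tanhHalf (-a) = - tanhHalf a := by
  induction a with
  | bot => simp [tanhHalf_top, tanhHalf_bot]
  | top => simp [tanhHalf_top, tanhHalf_bot]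
  | coe r => rw [← EReal.coe_neg, tanhHalf_coe, tanhHalf_coe, neg_div, Real.tanh_neg]

lemma abs_tanhHalf_le (a : EReal) : |tanhHalf a| ≤ 1 := by
  induction a with
  | bot => simp [tanhHalf_bot]
  | top => simp [tanhHalf_top]
  | coe r => rw [tanhHalf_coe]; exact (Real.abs_tanh_lt_one _).le

lemma measurable_tanhHalf : Measurable tanhHalf := by
  apply EReal.measurable_of_measurable_real
  simp only [tanhHalf_coe]
  simp only [Real.tanh_eq_sinh_div_cosh]
  fun_prop

lemma measurable_G : Measurable G := by
  unfold G Real.logb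
  fun_prop

lemma one_add_tanh (r : ℝ) : 1 + Real.tanh (r / 2) = 2 / (1 + Real.exp (-r)) := by
  rw [Real.tanh_eq_sinh_div_cosh, Real.sinh_eq, Real.cosh_eq]
  have h : Real.exp (-r) = Real.exp (-(r/2)) * Real.exp (-(r/2)) := by
    rw [← Real.exp_add]; ring_nf
  have h2 : Real.exp (r/2) * Real.exp (-(r/2)) = 1 := by rw [← Real.exp_add]; simp
  have := Real.exp_pos (r/2)
  have := Real.exp_pos (-(r/2))
  rw [h]
  field_simp
  linear_combination (2 * Real.exp (-(r/2))) * h2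

lemma entFn_eq (a : EReal) : entFn a = G (tanhHalf a) := by
  induction a with
  | bot => simp [entFn, G, tanhHalf_bot]
  | top => norm_num [entFn, G, tanhHalf_top]
  | coe r =>
    have : 0 < 1 + Real.exp (-r) := by positivity
    simp only [entFn, G, tanhHalf_coe, one_add_tanh, EReal.coe_ne_top, EReal.coe_ne_bot, if_false,
      EReal.toReal_coe]
    congr 1
    field_simp

lemma tanhHalf_atanhTwo (u : ℝ) (hu : |u| ≤ 1) : tanhHalf (atanhTwo u) = u := by
  rw [abs_le] at hu
  unfold atanhTwo
  split_ifs with h1 h2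
  · rw [tanhHalf_top]; linarith
  · rw [tanhHalf_bot]; linarith
  · push Not at h1 h2
    have h3 : 0 < 1 - u := by linarith
    have h4 : 0 < 1 + u := by linarith
    have := one_add_tanh (2 * artanh u)
    rw [tanhHalf_coe]
    have e : Real.exp (-(2 * artanh u)) = (1 - u) / (1 + u) := by
      unfold artanh
      rw [mul_div_cancel₀ _ (by norm_num : (2:ℝ) ≠ 0), Real.exp_neg, Real.exp_log (by positivity),
        inv_div]
    rw [e] at this
    have e2 : 2 / (1 + (1 - u) / (1 + u)) = 1 + u := by
      field_simp; ring
    linarith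

lemma measurable_atanhTwo : Measurable atanhTwo := by
  unfold atanhTwo artanh
  refine Measurable.ite measurableSet_Ici measurable_const
    (Measurable.ite measurableSet_Iic measurable_const ?_)
  exact Measurable.coe_real_ereal (by fun_prop)

lemma entFn_check (a b : EReal) :
    entFn (atanhTwo (tanhHalf a * tanhHalf b)) = G (tanhHalf a * tanhHalf b) := by
  rw [entFn_eq, tanhHalf_atanhTwo]
  rw [abs_mul]
  exact mul_le_one₀ (abs_tanhHalf_le a) (abs_nonneg _) (abs_tanhHalf_le b)

lemma G_nonneg {t : ℝ} (ht : |t| ≤ 1) : 0 ≤ G t := by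
  rw [abs_le] at ht
  rcases eq_or_lt_of_le ht.1 with h | h
  · simp [G, ← h]
  · apply Real.logb_nonneg (by norm_num)
    rw [le_div_iff₀ (by linarith)]; linarith

lemma hh_eq (t : ℝ) : hh t = (1 + t) / 2 * G t + (1 - t) / 2 * G (-t) := by
  unfold hh G Real.logb Real.binEntropy
  rw [show 1 - (1 + t) / 2 = (1 - t) / 2 by ring, inv_div, inv_div, ← sub_eq_add_neg]
  ring

lemma hh_neg (t : ℝ) : hh (-t) = hh t := by
  rw [hh_eq, hh_eq]; ring_nf

lemma hh_abs (t : ℝ) : hh |t| = hh t := by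
  rcases abs_choice t with h | h <;> rw [h]
  exact hh_neg t

lemma hh_nonneg {t : ℝ} (ht : |t| ≤ 1) : 0 ≤ hh t := by
  rw [abs_le] at ht
  apply div_nonneg (Real.binEntropy_nonneg (by linarith) (by linarith))
  exact Real.log_nonneg (by norm_num)

lemma hh_le_one (t : ℝ) : hh t ≤ 1 := by
  unfold hh
  rw [div_le_one (Real.log_pos (by norm_num))]
  exact Real.binEntropy_le_log_two

lemma continuous_hh : Continuous hh := by
  unfold hh
  have := Real.binEntropy_continuous
  fun_prop

/-- Pointwise duality. -/
lemma duality (a b : EReal) (ha : a ≠ ⊥) (hb : b ≠ ⊥) :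
    entFn (a + b) = entFn a + entFn b - G (tanhHalf a * tanhHalf b) := by
  induction a with
  | bot => exact absurd rfl ha
  | top =>
    rw [EReal.top_add_of_ne_bot hb, tanhHalf_top, one_mul, entFn_eq b]
    simp [entFn]
  | coe r =>
    induction b with
    | bot => exact absurd rfl hb
    | top =>
      rw [EReal.add_top_of_ne_bot ha, tanhHalf_top, mul_one, entFn_eq r]
      simp [entFn]
    | coe s =>
      have p1 := Real.exp_pos (-r)
      have p2 := Real.exp_pos (-s)
      have e : G (tanhHalf r * tanhHalf s) = Real.logb 2 ((1 + Real.exp (-r)) * (1 + Real.exp (-s))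
          / (1 + Real.exp (-(r+s)))) := by
        have h1 := one_add_tanh r
        have h2 := one_add_tanh s
        rw [tanhHalf_coe, tanhHalf_coe, eq_sub_of_add_eq' h1, eq_sub_of_add_eq' h2, G, neg_add,
          Real.exp_add]
        congr 1
        have h3 : 1 + (2 / (1 + Real.exp (-r)) - 1) * (2 / (1 + Real.exp (-s)) - 1)
          = 2 * (1 + Real.exp (-r) * Real.exp (-s)) /
            ((1 + Real.exp (-r)) * (1 + Real.exp (-s))) := by
          field_simp
          ring
        rw [h3]
        field_simp
      rw [e, Real.logb_div (by positivity) (by positivity),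
        Real.logb_mul (by positivity) (by positivity)]
      rw [← EReal.coe_add]
      simp only [entFn, EReal.coe_ne_top, EReal.coe_ne_bot, if_false, EReal.toReal_coe]
      ring

/-! ### Symmetric measures -/

/-- The even factor `1 / (2 cosh (α/2))`. -/
def cw (a : EReal) : ENNReal :=
  if a = ⊤ then 0 else if a = ⊥ then 0 else ENNReal.ofReal (1 / (2 * Real.cosh (a.toReal / 2)))

lemma cw_neg (a : EReal) : cw (-a) = cw a := by
  induction a with
  | bot => simp [cw]
  | top => simp [cw]
  | coe r =>
    rw [← EReal.coe_neg]
    simp only [cw, EReal.coe_ne_top, EReal.coe_ne_bot, if_false, EReal.toReal_coe, neg_div,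
      Real.cosh_neg]

lemma measurable_cw : Measurable cw := by
  apply EReal.measurable_of_measurable_real
  simp only [cw, EReal.coe_ne_top, EReal.coe_ne_bot, if_false, EReal.toReal_coe]
  fun_prop

lemma measurable_wt : Measurable wt := by
  apply EReal.measurable_of_measurable_real
  simp only [wt, EReal.coe_ne_top, EReal.coe_ne_bot, if_false, EReal.toReal_coe]
  fun_prop

/-- `(1 - tanh(α/2))/2` -/
def rm (a : EReal) : ENNReal := ENNReal.ofReal ((1 - tanhHalf a) / 2)

/-- `(1 + tanh(α/2))/2` -/
def rp (a : EReal) : ENNReal := ENNReal.ofReal ((1 + tanhHalf a) / 2)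

lemma measurable_rm : Measurable rm := by
  have := measurable_tanhHalf
  unfold rm; fun_prop

lemma measurable_rp : Measurable rp := by
  have := measurable_tanhHalf
  unfold rp; fun_prop

lemma rp_add_rm (a : EReal) : rp a + rm a = 1 := by
  have := abs_le.1 (abs_tanhHalf_le a)
  unfold rp rm
  rw [← ENNReal.ofReal_add (by linarith) (by linarith), ← ENNReal.ofReal_one]
  congr 1
  ring

lemma wt_mul_cw (a : EReal) (ha : a ≠ ⊥) : wt a * cw a = rm a := by
  induction a with
  | bot => exact absurd rfl ha
  | top => simp [wt, rm, tanhHalf_top]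
  | coe r =>
    simp only [wt, cw, rm, tanhHalf_coe, EReal.coe_ne_top, EReal.coe_ne_bot, if_false,
      EReal.toReal_coe]
    rw [← ENNReal.ofReal_mul (Real.exp_pos _).le, neg_div, ← Real.cosh_sub_sinh,
      Real.tanh_eq_sinh_div_cosh]
    have := Real.cosh_pos (r / 2)
    congr 1
    field_simp

lemma symm_bot {μ : Measure EReal} (h : IsSymmMeasure μ) : μ {⊥} = 0 := by
  have := h {⊤} (measurableSet_singleton _)
  have e : (fun a : EReal => -a) ⁻¹' {⊤} = {⊥} := by
    ext a
    simp
  rw [e, lintegral_singleton, lintegral_singleton] at this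
  by_contra hne
  simp [wt, hne] at this

lemma symm_ae {μ : Measure EReal} (h : IsSymmMeasure μ) : ∀ᵐ a ∂μ, a ≠ ⊥ := by
  rw [ae_iff]
  simpa using symm_bot h

lemma measurable_neg_ereal : Measurable (fun a : EReal => -a) := continuous_neg.measurable

lemma symm_lint {μ : Measure EReal} (h : IsSymmMeasure μ) (f : EReal → ENNReal)
    (hf : Measurable f) : ∫⁻ a, f (-a) * rm a ∂μ = ∫⁻ a, f a * rm a ∂μ := by
  have hmap : (μ.withDensity wt).map (fun a => -a) = μ.withDensity wt := by
    ext E hE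
    rw [Measure.map_apply measurable_neg_ereal hE, withDensity_apply _ (measurable_neg_ereal hE),
      withDensity_apply _ hE]
    exact h E hE
  have key : ∀ g : EReal → ENNReal, Measurable g →
      ∫⁻ a, g a * rm a ∂μ = ∫⁻ a, g a * cw a ∂(μ.withDensity wt) := by
    intro g hg
    have mg : Measurable fun a => g a * cw a := hg.mul measurable_cw
    rw [lintegral_withDensity_eq_lintegral_mul _ measurable_wt mg]
    apply lintegral_congr_ae
    filter_upwards [symm_ae h] with a ha
    rw [← wt_mul_cw a ha]
    simp only [Pi.mul_apply]
    ring
  have mf : Measurable fun a => f a * cw a := hf.mul measurable_cw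
  rw [key f hf, key (fun a => f (-a)) (hf.comp measurable_neg_ereal)]
  conv_rhs => rw [← hmap]
  rw [lintegral_map mf measurable_neg_ereal]
  simp only [cw_neg]

lemma symm_lint' {μ : Measure EReal} (h : IsSymmMeasure μ) (f : EReal → ENNReal)
    (hf : Measurable f) : ∫⁻ a, f a ∂μ = ∫⁻ a, (f a * rp a + f (-a) * rm a) ∂μ := by
  have mf : Measurable fun a => f a * rp a := hf.mul measurable_rp
  rw [lintegral_add_left mf, symm_lint h f hf, ← lintegral_add_left mf]
  congr 1
  ext a
  rw [← mul_add, rp_add_rm, mul_one]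

lemma abs_mul_tanhHalf_le (a b : EReal) : |tanhHalf a * tanhHalf b| ≤ 1 := by
  rw [abs_mul]
  exact mul_le_one₀ (abs_tanhHalf_le a) (abs_nonneg _) (abs_tanhHalf_le b)

lemma lint_check {μ ν : Measure EReal} [IsFiniteMeasure μ] [IsFiniteMeasure ν]
    (hμ : IsSymmMeasure μ) (hν : IsSymmMeasure ν) :
    ∫⁻ z, ENNReal.ofReal (G (tanhHalf z.1 * tanhHalf z.2)) ∂(μ.prod ν)
      = ∫⁻ z, ENNReal.ofReal (hh (tanhHalf z.1 * tanhHalf z.2)) ∂(μ.prod ν) := by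
  have mt := measurable_tanhHalf
  have mG := measurable_G
  have mr := measurable_rm
  have mp := measurable_rp
  have mn := measurable_neg_ereal
  have mh := continuous_hh.measurable
  have mk : Measurable fun z : EReal × EReal =>
      ENNReal.ofReal (G (tanhHalf z.1 * tanhHalf z.2)) := by fun_prop
  have mk2 : Measurable fun z : EReal × EReal =>
      ENNReal.ofReal (G (tanhHalf z.1 * tanhHalf z.2)) * rp z.2
       + ENNReal.ofReal (G (tanhHalf z.1 * tanhHalf (-z.2))) * rm z.2 := by fun_prop
  have mk3 : Measurable fun z : EReal × EReal =>
      ENNReal.ofReal (hh (tanhHalf z.1 * tanhHalf z.2)) := by fun_prop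
  rw [lintegral_prod _ mk.aemeasurable, lintegral_prod_symm _ mk3.aemeasurable]
  have s1 : ∀ a, ∫⁻ b, ENNReal.ofReal (G (tanhHalf a * tanhHalf b)) ∂ν =
     ∫⁻ b, (ENNReal.ofReal (G (tanhHalf a * tanhHalf b)) * rp b
       + ENNReal.ofReal (G (tanhHalf a * tanhHalf (-b))) * rm b) ∂ν := fun a =>
    symm_lint' hν (fun b => ENNReal.ofReal (G (tanhHalf a * tanhHalf b))) (by fun_prop)
  simp only [s1]
  rw [lintegral_lintegral_swap mk2.aemeasurable]
  congr 1
  ext b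
  rw [symm_lint' hμ _ (by fun_prop)]
  congr 1
  ext a
  have ha := abs_le.1 (abs_tanhHalf_le a)
  have hb := abs_le.1 (abs_tanhHalf_le b)
  have hab := abs_mul_tanhHalf_le a b
  have g1 := G_nonneg hab
  have g2 : 0 ≤ G (-(tanhHalf a * tanhHalf b)) := G_nonneg (by rwa [abs_neg])
  simp only [tanhHalf_neg, mul_neg, neg_mul, neg_neg, rp, rm]
  have q1 : 0 ≤ (1 + tanhHalf a) / 2 := by linarith
  have q2 : 0 ≤ (1 - tanhHalf a) / 2 := by linarith
  have q3 : 0 ≤ (1 + tanhHalf b) / 2 := by linarith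
  have q4 : 0 ≤ (1 - tanhHalf b) / 2 := by linarith
  rw [← ENNReal.ofReal_mul g1, ← ENNReal.ofReal_mul g2, ← ENNReal.ofReal_mul g1,
    ← ENNReal.ofReal_mul g2, ← ENNReal.ofReal_add (by positivity) (by positivity),
    ← ENNReal.ofReal_add (by positivity) (by positivity),
    ← ENNReal.ofReal_mul (by positivity), ← ENNReal.ofReal_mul (by positivity),
    ← ENNReal.ofReal_add (by positivity) (by positivity), hh_eq]
  congr 1
  ring

lemma lint_ent {μ : Measure EReal} (hμ : IsSymmMeasure μ) :
    ∫⁻ a, ENNReal.ofReal (entFn a) ∂μ = ∫⁻ a, ENNReal.ofReal (hh (tanhHalf a)) ∂μ := by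
  have mt := measurable_tanhHalf
  have mG := measurable_G
  simp only [entFn_eq]
  rw [symm_lint' hμ _ (by fun_prop)]
  congr 1
  ext a
  have ha := abs_le.1 (abs_tanhHalf_le a)
  have g1 := G_nonneg (abs_tanhHalf_le a)
  have g2 : 0 ≤ G (-(tanhHalf a)) := G_nonneg (by rw [abs_neg]; exact abs_tanhHalf_le a)
  have q1 : 0 ≤ (1 + tanhHalf a) / 2 := by linarith
  have q2 : 0 ≤ (1 - tanhHalf a) / 2 := by linarith
  simp only [tanhHalf_neg, rp, rm]
  rw [← ENNReal.ofReal_mul g1, ← ENNReal.ofReal_mul g2,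
    ← ENNReal.ofReal_add (by positivity) (by positivity), hh_eq]
  congr 1
  ring

lemma measurable_entFn : Measurable entFn := by
  rw [show entFn = fun a => G (tanhHalf a) from funext entFn_eq]
  exact measurable_G.comp measurable_tanhHalf

lemma entFn_nonneg (a : EReal) : 0 ≤ entFn a := by
  rw [entFn_eq]; exact G_nonneg (abs_tanhHalf_le a)

/-- transfer of integrability and integral through `lintegral`. -/
lemma transfer {Ω : Type*} [MeasurableSpace Ω] {m : Measure Ω} [IsFiniteMeasure m] {f g : Ω → ℝ}
    (hf : Measurable f) (hg : Measurable g) (hf0 : ∀ z, 0 ≤ f z) (hg0 : ∀ z, 0 ≤ g z)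
    (hg1 : ∀ z, g z ≤ 1)
    (h : ∫⁻ z, ENNReal.ofReal (f z) ∂m = ∫⁻ z, ENNReal.ofReal (g z) ∂m) :
    Integrable f m ∧ Integrable g m ∧ ∫ z, f z ∂m = ∫ z, g z ∂m := by
  have ig : Integrable g m := by
    refine Integrable.of_bound hg.aestronglyMeasurable 1 (Eventually.of_forall fun z => ?_)
    rw [Real.norm_of_nonneg (hg0 z)]; exact hg1 z
  refine ⟨?_, ig, ?_⟩
  · refine ⟨hf.aestronglyMeasurable, ?_⟩
    rw [hasFiniteIntegral_iff_ofReal (Eventually.of_forall hf0), h,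
      ← hasFiniteIntegral_iff_ofReal (Eventually.of_forall hg0)]
    exact ig.2
  · rw [integral_eq_lintegral_of_nonneg_ae (Eventually.of_forall hf0) hf.aestronglyMeasurable, h,
      ← integral_eq_lintegral_of_nonneg_ae (Eventually.of_forall hg0) hg.aestronglyMeasurable]

lemma ent_transfer {μ : Measure EReal} [IsFiniteMeasure μ] (hμ : IsSymmMeasure μ) :
    Integrable entFn μ ∧ Integrable (fun a => hh (tanhHalf a)) μ ∧
      ∫ a, entFn a ∂μ = ∫ a, hh (tanhHalf a) ∂μ :=
  transfer measurable_entFn (continuous_hh.measurable.comp measurable_tanhHalf) entFn_nonneg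
    (fun a => hh_nonneg (abs_tanhHalf_le a)) (fun _ => hh_le_one _) (lint_ent hμ)

lemma check_transfer {μ ν : Measure EReal} [IsFiniteMeasure μ] [IsFiniteMeasure ν]
    (hμ : IsSymmMeasure μ) (hν : IsSymmMeasure ν) :
    Integrable (fun z : EReal × EReal => G (tanhHalf z.1 * tanhHalf z.2)) (μ.prod ν) ∧
    Integrable (fun z : EReal × EReal => hh (tanhHalf z.1 * tanhHalf z.2)) (μ.prod ν) ∧
      ∫ z, G (tanhHalf z.1 * tanhHalf z.2) ∂(μ.prod ν)
        = ∫ z, hh (tanhHalf z.1 * tanhHalf z.2) ∂(μ.prod ν) := by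
  have mt := measurable_tanhHalf
  have mG := measurable_G
  have mh := continuous_hh.measurable
  exact transfer (by fun_prop) (by fun_prop) (fun z => G_nonneg (abs_mul_tanhHalf_le _ _))
    (fun z => hh_nonneg (abs_mul_tanhHalf_le _ _)) (fun _ => hh_le_one _) (lint_check hμ hν)

/-! ### Concavity -/

lemma log_two_pos' : 0 < Real.log 2 := Real.log_pos (by norm_num)

lemma hh_anti : AntitoneOn hh (Set.Icc 0 1) := by
  intro x hx y hy hxy
  unfold hh
  apply div_le_div_of_nonneg_right _ log_two_pos'.le
  exact Real.binEntropy_strictAntiOn.antitoneOn ⟨by linarith [hx.1], by linarith [hx.2]⟩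
    ⟨by linarith [hy.1], by linarith [hy.2]⟩ (by linarith)

lemma hh_concave : ConcaveOn ℝ (Set.Icc 0 1) hh := by
  refine ⟨convex_Icc 0 1, ?_⟩
  intro x hx y hy a b ha hb hab
  have := Real.strictConcave_binEntropy.concaveOn.2 (x := (1 + x)/2) (y := (1 + y)/2)
    ⟨by linarith [hx.1], by linarith [hx.2]⟩ ⟨by linarith [hy.1], by linarith [hy.2]⟩ ha hb hab
  simp only [smul_eq_mul] at this ⊢
  unfold hh
  rw [← mul_div_assoc, ← mul_div_assoc, ← add_div]
  apply div_le_div_of_nonneg_right _ log_two_pos'.le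
  convert this using 2
  linear_combination -(1/2) * hab

lemma scale_mem {s x : ℝ} (hs : s ∈ Set.Icc (0:ℝ) 1) (hx : x ∈ Set.Icc (0:ℝ) 1) :
    x * s ∈ Set.Icc (0:ℝ) 1 :=
  ⟨mul_nonneg hx.1 hs.1, mul_le_one₀ hx.2 hs.1 hs.2⟩

lemma hs_anti {s : ℝ} (hs : s ∈ Set.Icc (0:ℝ) 1) :
    AntitoneOn (fun t => hh (t * s)) (Set.Icc 0 1) := fun _ hx _ hy hxy =>
  hh_anti (scale_mem hs hx) (scale_mem hs hy) (mul_le_mul_of_nonneg_right hxy hs.1)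

lemma hs_concave {s : ℝ} (hs : s ∈ Set.Icc (0:ℝ) 1) :
    ConcaveOn ℝ (Set.Icc 0 1) (fun t => hh (t * s)) := by
  refine ⟨convex_Icc 0 1, ?_⟩
  intro x hx y hy a b ha hb hab
  have := hh_concave.2 (scale_mem hs hx) (scale_mem hs hy) ha hb hab
  simp only [smul_eq_mul] at this ⊢
  convert this using 2
  ring

/-- derivative of `hh` up to a factor. -/
lemma hh_deriv {t : ℝ} (ht : t ∈ Set.Ioo (-1:ℝ) 1) :
    HasDerivAt hh ((Real.log (1 - t) - Real.log (1 + t)) / (2 * Real.log 2)) t := by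
  have h1 := Real.hasDerivAt_binEntropy (p := (1 + t) / 2) (by linarith [ht.1])
    (by linarith [ht.2])
  have h2 : HasDerivAt (fun t : ℝ => (1 + t) / 2) (1 / 2) t :=
    ((hasDerivAt_id t).const_add 1).div_const 2
  have h3 := (h1.comp t h2).div_const (Real.log 2)
  refine h3.congr_deriv ?_
  have p1 : 1 - t ≠ 0 := by linarith [ht.2]
  have p2 : 1 + t ≠ 0 := by linarith [ht.1]
  rw [show 1 - (1 + t) / 2 = (1 - t) / 2 by ring, Real.log_div p1 (by norm_num),
    Real.log_div p2 (by norm_num)]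
  have := log_two_pos'
  field_simp
  ring

lemma F_deriv {s t : ℝ} (hs : s ∈ Set.Icc (0:ℝ) 1) (ht : t ∈ Set.Ioo (0:ℝ) 1) :
    HasDerivAt (fun t => hh t - hh (t * s))
      (((Real.log (1 - t) - Real.log (1 + t))
        - s * (Real.log (1 - t * s) - Real.log (1 + t * s))) / (2 * Real.log 2)) t := by
  have m := mul_nonneg ht.1.le hs.1
  have m' : t * s ≤ t * 1 := mul_le_mul_of_nonneg_left hs.2 ht.1.le
  have h1 := hh_deriv (t := t) ⟨by linarith [ht.1], ht.2⟩
  have h2 := hh_deriv (t := t * s) ⟨by linarith, by linarith [ht.2]⟩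
  have h3 : HasDerivAt (fun t => t * s) (1 * s) t := (hasDerivAt_id t).mul_const s
  refine (h1.sub (h2.comp t h3)).congr_deriv ?_
  ring

lemma D_deriv {s t : ℝ} (hs : s ∈ Set.Icc (0:ℝ) 1) (ht : t ∈ Set.Ioo (0:ℝ) 1) :
    HasDerivAt (fun t => (((Real.log (1 - t) - Real.log (1 + t))
        - s * (Real.log (1 - t * s) - Real.log (1 + t * s))) / (2 * Real.log 2)))
      (((-1 / (1 - t) - 1 / (1 + t)) - s * (-s / (1 - t * s) - s / (1 + t * s)))
        / (2 * Real.log 2)) t := by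
  have m := mul_nonneg ht.1.le hs.1
  have m' : t * s ≤ t * 1 := mul_le_mul_of_nonneg_left hs.2 ht.1.le
  have a1 : HasDerivAt (fun t : ℝ => 1 - t) (-1) t := by
    simpa using (hasDerivAt_id t).const_sub 1
  have a2 : HasDerivAt (fun t : ℝ => 1 + t) 1 t := by
    simpa using (hasDerivAt_id t).const_add 1
  have a0 : HasDerivAt (fun t : ℝ => t * s) s t := by
    simpa using (hasDerivAt_id t).mul_const s
  have a3 : HasDerivAt (fun t : ℝ => 1 - t * s) (-s) t := a0.const_sub 1
  have a4 : HasDerivAt (fun t : ℝ => 1 + t * s) s t := a0.const_add 1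
  have l1 := a1.log (by linarith [ht.2])
  have l2 := a2.log (by linarith [ht.1])
  have l3 := a3.log (by linarith [ht.2])
  have l4 := a4.log (by linarith [ht.1])
  exact ((l1.sub l2).sub ((l3.sub l4).const_mul s)).div_const _

lemma F_cont (s : ℝ) : Continuous (fun t => hh t - hh (t * s)) := by
  have := continuous_hh
  fun_prop

lemma F_concave {s : ℝ} (hs : s ∈ Set.Icc (0:ℝ) 1) :
    ConcaveOn ℝ (Set.Icc 0 1) (fun t => hh t - hh (t * s)) := by
  refine concaveOn_of_hasDerivWithinAt2_nonpos (convex_Icc 0 1) (F_cont s).continuousOn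
    (f' := fun t => (((Real.log (1 - t) - Real.log (1 + t))
        - s * (Real.log (1 - t * s) - Real.log (1 + t * s))) / (2 * Real.log 2)))
    (f'' := fun t => (((-1 / (1 - t) - 1 / (1 + t)) - s * (-s / (1 - t * s) - s / (1 + t * s)))
        / (2 * Real.log 2))) ?_ ?_ ?_
  · intro t ht
    rw [interior_Icc] at ht
    exact (F_deriv hs ht).hasDerivWithinAt
  · intro t ht
    rw [interior_Icc] at ht
    exact (D_deriv hs ht).hasDerivWithinAt
  · intro t ht
    rw [interior_Icc] at ht
    have m := mul_nonneg ht.1.le hs.1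
    have m' : t * s ≤ t * 1 := mul_le_mul_of_nonneg_left hs.2 ht.1.le
    have p1 : 0 < 1 - t := by linarith [ht.2]
    have p2 : 0 < 1 + t := by linarith [ht.1]
    have p3 : 0 < 1 - t * s := by linarith
    have p4 : 0 < 1 + t * s := by linarith
    apply div_nonpos_of_nonpos_of_nonneg _ (by linarith [log_two_pos'])
    have e : (-1 / (1 - t) - 1 / (1 + t)) - s * (-s / (1 - t * s) - s / (1 + t * s))
        = -2 * (1 - s ^ 2) / ((1 - t) * (1 + t) * ((1 - t * s) * (1 + t * s))) := by
      field_simp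
      ring
    rw [e]
    apply div_nonpos_of_nonpos_of_nonneg _ (by positivity)
    nlinarith [hs.1, hs.2]

lemma F_anti {s : ℝ} (hs : s ∈ Set.Icc (0:ℝ) 1) :
    AntitoneOn (fun t => hh t - hh (t * s)) (Set.Icc 0 1) := by
  refine antitoneOn_of_hasDerivWithinAt_nonpos (convex_Icc 0 1) (F_cont s).continuousOn
    (f' := fun t => (((Real.log (1 - t) - Real.log (1 + t))
        - s * (Real.log (1 - t * s) - Real.log (1 + t * s))) / (2 * Real.log 2))) ?_ ?_
  · intro t ht
    rw [interior_Icc] at ht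
    exact (F_deriv hs ht).hasDerivWithinAt
  · intro t ht
    rw [interior_Icc] at ht
    have m := mul_nonneg ht.1.le hs.1
    have m' : t * s ≤ t * 1 := mul_le_mul_of_nonneg_left hs.2 ht.1.le
    apply div_nonpos_of_nonpos_of_nonneg _ (by linarith [log_two_pos'])
    have l1 : Real.log (1 - t) ≤ Real.log (1 - t * s) :=
      Real.log_le_log (by linarith [ht.2]) (by linarith)
    have l2 : Real.log (1 + t * s) ≤ Real.log (1 + t) :=
      Real.log_le_log (by linarith) (by linarith)
    have l3 : Real.log (1 - t * s) ≤ Real.log (1 + t * s) :=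
      Real.log_le_log (by linarith [ht.2]) (by linarith)
    nlinarith [hs.1, hs.2]

/-! ### Assembling the proof -/

lemma symm_add {μ ν : Measure EReal} (hμ : IsSymmMeasure μ) (hν : IsSymmMeasure ν) :
    IsSymmMeasure (μ + ν) := by
  intro E hE
  rw [Measure.restrict_add, Measure.restrict_add, lintegral_add_measure, lintegral_add_measure,
    hμ E hE, hν E hE]

lemma memX_iff {x : SM} (h : MemX x) : ∃ (μ : Measure EReal) (_ : IsProbabilityMeasure μ),
    x = μ.toSignedMeasure ∧ IsSymmMeasure μ := by
  obtain ⟨⟨μ, hμ, rfl⟩, hs⟩ := h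
  refine ⟨μ, hμ, rfl, ?_⟩
  have := hs.1
  rwa [jp_pos] at this

lemma sInt_four (A B C D : Measure EReal) [IsFiniteMeasure A] [IsFiniteMeasure B]
    [IsFiniteMeasure C] [IsFiniteMeasure D] (f : EReal → ℝ) (hA : Integrable f A)
    (hB : Integrable f B) (hC : Integrable f C) (hD : Integrable f D) :
    sInt f (A.toSignedMeasure - B.toSignedMeasure - C.toSignedMeasure + D.toSignedMeasure)
      = ∫ a, f a ∂A - ∫ a, f a ∂B - ∫ a, f a ∂C + ∫ a, f a ∂D := by
  have e : A.toSignedMeasure - B.toSignedMeasure - C.toSignedMeasure + D.toSignedMeasure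
      = (A + D).toSignedMeasure - (B + C).toSignedMeasure := by
    rw [Measure.toSignedMeasure_add, Measure.toSignedMeasure_add]
    abel
  rw [e, sInt_sub _ _ _ (hA.add_measure hD) (hB.add_measure hC), integral_add_measure hA hD,
    integral_add_measure hB hC]
  ring

/-- Expansion of the entropy of a bilinear expression. -/
lemma expand (op : EReal × EReal → EReal) (hop : Measurable op)
    (μ' μ ν ν' : Measure EReal) [IsFiniteMeasure μ']
    [IsFiniteMeasure μ] [IsFiniteMeasure ν] [IsFiniteMeasure ν']
    (hk : Integrable (fun z => entFn (op z)) ((μ' + μ).prod (ν + ν'))) (p n P N : Measure EReal)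
    [IsFiniteMeasure p] [IsFiniteMeasure n] [IsFiniteMeasure P] [IsFiniteMeasure N]
    (hp : p ≤ μ') (hn : n ≤ μ) (hP : P ≤ ν) (hN : N ≤ ν')
    (h1 : p + μ = n + μ') (h2 : P + ν' = N + ν) :
    H (((p.prod P).map op).toSignedMeasure - ((p.prod N).map op).toSignedMeasure
      - ((n.prod P).map op).toSignedMeasure + ((n.prod N).map op).toSignedMeasure) =
      ∫ z, entFn (op z) ∂(μ'.prod ν) - ∫ z, entFn (op z) ∂(μ'.prod ν')
      - ∫ z, entFn (op z) ∂(μ.prod ν) + ∫ z, entFn (op z) ∂(μ.prod ν') := by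
  have a1 : μ' ≤ μ' + μ := Measure.le_add_right le_rfl
  have a2 : μ ≤ μ' + μ := Measure.le_add_left le_rfl
  have b1 : ν ≤ ν + ν' := Measure.le_add_right le_rfl
  have b2 : ν' ≤ ν + ν' := Measure.le_add_left le_rfl
  have I : ∀ (A B : Measure EReal) [IsFiniteMeasure A] [IsFiniteMeasure B],
      A ≤ μ' + μ → B ≤ ν + ν' → Integrable entFn ((A.prod B).map op) := fun A B _ _ hA hB =>
    (integrable_map_measure measurable_entFn.aestronglyMeasurable hop.aemeasurable).2
      (hk.mono_measure (Measure.prod_mono hA hB))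
  unfold H
  rw [sInt_four _ _ _ _ _ (I p P (hp.trans a1) (hP.trans b1)) (I p N (hp.trans a1) (hN.trans b2))
    (I n P (hn.trans a2) (hP.trans b1)) (I n N (hn.trans a2) (hN.trans b2))]
  simp only [integral_map hop.aemeasurable measurable_entFn.aestronglyMeasurable]
  exact bilin _ μ' μ ν ν' hk p n P N hp hn hP hN h1 h2

lemma conv_transfer {μ ν : Measure EReal} [IsFiniteMeasure μ] [IsFiniteMeasure ν]
    (hμ : IsSymmMeasure μ) (hν : IsSymmMeasure ν) :
    (fun z : EReal × EReal => entFn (z.1 + z.2)) =ᵐ[μ.prod ν]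
      fun z => entFn z.1 + entFn z.2 - G (tanhHalf z.1 * tanhHalf z.2) := by
  have h1 := Measure.quasiMeasurePreserving_fst (μ := μ) (ν := ν) |>.ae (symm_ae hμ)
  have h2 := Measure.quasiMeasurePreserving_snd (μ := μ) (ν := ν) |>.ae (symm_ae hν)
  filter_upwards [h1, h2] with z hz1 hz2
  exact duality _ _ hz1 hz2

lemma conv_integrable {μ ν : Measure EReal} [IsFiniteMeasure μ] [IsFiniteMeasure ν]
    (hμ : IsSymmMeasure μ) (hν : IsSymmMeasure ν) :
    Integrable (fun z : EReal × EReal => entFn (z.1 + z.2)) (μ.prod ν) := by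
  refine Integrable.congr ?_ (conv_transfer hμ hν).symm
  exact (((ent_transfer hμ).1.comp_fst ν).add ((ent_transfer hν).1.comp_snd μ)).sub
    (check_transfer hμ hν).1

lemma conv_integral {μ ν : Measure EReal} [IsProbabilityMeasure μ] [IsProbabilityMeasure ν]
    (hμ : IsSymmMeasure μ) (hν : IsSymmMeasure ν) :
    ∫ z, entFn (z.1 + z.2) ∂(μ.prod ν) = ∫ a, entFn a ∂μ + ∫ b, entFn b ∂ν
      - ∫ z, G (tanhHalf z.1 * tanhHalf z.2) ∂(μ.prod ν) := by
  have i1 := (ent_transfer hμ).1.comp_fst ν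
  have i2 := (ent_transfer hν).1.comp_snd μ
  rw [integral_congr_ae (conv_transfer hμ hν),
    integral_sub (f := fun z : EReal × EReal => entFn z.1 + entFn z.2) (i1.add i2)
      (check_transfer hμ hν).1,
    integral_add i1 i2, integral_fun_fst, integral_fun_snd]
  simp

/-- integral of `hh (t s)` -/
def HS (μ : Measure EReal) (s : ℝ) : ℝ := ∫ a, hh (tanhHalf a * s) ∂μ

lemma hs_integrable (μ : Measure EReal) [IsFiniteMeasure μ] {s : ℝ} (hs : |s| ≤ 1) :
    Integrable (fun a => hh (tanhHalf a * s)) μ := by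
  have mt := measurable_tanhHalf
  have mh := continuous_hh.measurable
  have m : Measurable fun a => hh (tanhHalf a * s) := by fun_prop
  refine Integrable.of_bound m.aestronglyMeasurable 1 (Eventually.of_forall fun a => ?_)
  rw [Real.norm_of_nonneg]
  · exact hh_le_one _
  · apply hh_nonneg
    rw [abs_mul]
    exact mul_le_one₀ (abs_tanhHalf_le a) (abs_nonneg _) hs

lemma hh_abs_mul (t s : ℝ) : hh (|t| * |s|) = hh (t * s) := by rw [← abs_mul, hh_abs]

lemma HS_bounds (μ' μ : Measure EReal) [IsFiniteMeasure μ'] [IsFiniteMeasure μ]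
    (hdeg : Degraded μ'.toSignedMeasure μ.toSignedMeasure) {s : ℝ} (hs : |s| ≤ 1) :
    0 ≤ HS μ' s - HS μ s ∧ HS μ' s - HS μ s ≤ HS μ' 1 - HS μ 1 := by
  have hs' : |s| ∈ Set.Icc (0:ℝ) 1 := ⟨abs_nonneg _, hs⟩
  have one : |(1:ℝ)| ≤ 1 := by simp
  constructor
  · have := hdeg _ (hs_concave hs') (hs_anti hs')
    unfold If at this
    simp only [hh_abs_mul] at this
    rw [sInt_pos _ _ (hs_integrable μ hs), sInt_pos _ _ (hs_integrable μ' hs)] at this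
    unfold HS
    linarith
  · have := hdeg _ (F_concave hs') (F_anti hs')
    have e : ∀ t : ℝ, hh |t| = hh (t * 1) := fun t => by rw [hh_abs, mul_one]
    unfold If at this
    simp only [hh_abs_mul, e] at this
    rw [sInt_pos _ (fun α => hh (tanhHalf α * 1) - hh (tanhHalf α * s)) ((hs_integrable μ one).sub (hs_integrable μ hs)),
      sInt_pos _ (fun α => hh (tanhHalf α * 1) - hh (tanhHalf α * s)) ((hs_integrable μ' one).sub (hs_integrable μ' hs)),
      integral_sub (hs_integrable μ one) (hs_integrable μ hs),
      integral_sub (hs_integrable μ' one) (hs_integrable μ' hs)] at this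
    unfold HS
    linarith

lemma check_bounds (μ' μ ν : Measure EReal) [IsProbabilityMeasure μ'] [IsProbabilityMeasure μ]
    [IsProbabilityMeasure ν] (hμ' : IsSymmMeasure μ') (hμ : IsSymmMeasure μ)
    (hν : IsSymmMeasure ν)
    (hdeg : Degraded μ'.toSignedMeasure μ.toSignedMeasure) :
    0 ≤ ∫ z, G (tanhHalf z.1 * tanhHalf z.2) ∂(μ'.prod ν)
        - ∫ z, G (tanhHalf z.1 * tanhHalf z.2) ∂(μ.prod ν) ∧
      ∫ z, G (tanhHalf z.1 * tanhHalf z.2) ∂(μ'.prod ν)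
        - ∫ z, G (tanhHalf z.1 * tanhHalf z.2) ∂(μ.prod ν) ≤ HS μ' 1 - HS μ 1 := by
  obtain ⟨-, i', e'⟩ := check_transfer hμ' hν
  obtain ⟨-, i, e⟩ := check_transfer hμ hν
  rw [e', e, integral_prod_symm _ i', integral_prod_symm _ i,
    ← integral_sub i'.integral_prod_right i.integral_prod_right]
  have hb := fun b => HS_bounds μ' μ hdeg (abs_tanhHalf_le b)
  unfold HS at hb
  constructor
  · exact integral_nonneg fun b => (hb b).1
  · calc _ ≤ ∫ _b, (HS μ' 1 - HS μ 1) ∂ν :=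
          integral_mono (i'.integral_prod_right.sub i.integral_prod_right) (integrable_const _)
            fun b => (hb b).2
      _ = _ := by simp

/-- If `x1, x1', x2, x3 ∈ X` with `x1' ⪰ x1`, then
`|H((x1' - x1) ∗ (x2 - x3))| ≤ H(x1' - x1)` for `∗` either `⊛` or `⊠`. -/
theorem entropy_bound
    (x1 x1' x2 x3 : SM) (h1 : MemX x1) (h1' : MemX x1') (h2 : MemX x2) (h3 : MemX x3)
    (hdeg : Degraded x1' x1) :
    |H (sConv (x1' - x1) (x2 - x3))| ≤ H (x1' - x1) ∧
    |H (sCheck (x1' - x1) (x2 - x3))| ≤ H (x1' - x1) := by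

  obtain ⟨μ, _, rfl, hμ⟩ := memX_iff h1
  obtain ⟨μ', _, rfl, hμ'⟩ := memX_iff h1'
  obtain ⟨ν, _, rfl, hν⟩ := memX_iff h2
  obtain ⟨ν', _, rfl, hν'⟩ := memX_iff h3
  have hH : H (μ'.toSignedMeasure - μ.toSignedMeasure) = HS μ' 1 - HS μ 1 := by
    unfold H HS
    rw [sInt_sub _ _ _ (ent_transfer hμ').1 (ent_transfer hμ).1, (ent_transfer hμ').2.2,
      (ent_transfer hμ).2.2]
    simp only [mul_one]
  have B := check_bounds μ' μ ν hμ' hμ hν hdeg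
  have B' := check_bounds μ' μ ν' hμ' hμ hν' hdeg
  have mt := measurable_tanhHalf
  have ma := measurable_atanhTwo
  constructor
  · have E := expand (fun z => z.1 + z.2) (measurable_fst.add measurable_snd) μ' μ ν ν'
      (conv_integrable (symm_add hμ' hμ) (symm_add hν hν')) _ _ _ _ (jp_le μ' μ) (jn_le μ' μ)
      (jp_le ν ν') (jn_le ν ν') (jordan_add μ' μ) (jordan_add ν ν')
    have E2 : H (sConv (μ'.toSignedMeasure - μ.toSignedMeasure)
      (ν.toSignedMeasure - ν'.toSignedMeasure)) = _ := E
    rw [E2, hH, conv_integral hμ' hν, conv_integral hμ' hν', conv_integral hμ hν,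
      conv_integral hμ hν', abs_le]
    constructor <;> linarith [B.1, B.2, B'.1, B'.2]
  · have E := expand (fun z => atanhTwo (tanhHalf z.1 * tanhHalf z.2)) (by fun_prop) μ' μ ν ν'
      (by simp only [entFn_check]
          exact (check_transfer (symm_add hμ' hμ) (symm_add hν hν')).1) _ _ _ _
      (jp_le μ' μ) (jn_le μ' μ)
      (jp_le ν ν') (jn_le ν ν') (jordan_add μ' μ) (jordan_add ν ν')
    have E2 : H (sCheck (μ'.toSignedMeasure - μ.toSignedMeasure)
      (ν.toSignedMeasure - ν'.toSignedMeasure)) = _ := E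
    rw [E2, hH]
    simp only [entFn_check]
    rw [abs_le]
    constructor <;> linarith [B.1, B.2, B'.1, B'.2]

end SCLDPC
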